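/- The neighborhood N = {(0,1), (1,0), (−1,0), (1,−1), (−1,−1)} (neighborhood 211 in the 8-bit numbering of subsets of the Moore neighborhood) admits a timed crossover gate of size 12 × 12 and delay 17. -/

import Mathlib

/-! Sandpile models on ℤ² and timed crossover gates. -/

abbrev Cell : Type := ℤ × ℤ
abbrev Config : Type := Cell → ℕ

namespace Sandpile

/-- The threshold of a sandpile model is the cardinality of its neighborhood. -/
def θ (𝒩 : Finset Cell) : ℕ := 𝒩.card

/-- The parallel sandpile dynamics: each cell reaching the threshold topples,
sending one grain to each of its out-neighbors. -/
def F (𝒩 : Finset Cell) (c : Config) : Config := fun p =>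
  c p - θ 𝒩 * (if θ 𝒩 ≤ c p then 1 else 0)
    + ∑ p' ∈ 𝒩, (if θ 𝒩 ≤ c (p - p') then 1 else 0)

/-- The configuration with a single grain at cell `p`. -/
def one (p : Cell) : Config := fun q => if q = p then 1 else 0

/-- A configuration is stable when every cell is below the threshold. -/
def Stable (𝒩 : Finset Cell) (c : Config) : Prop := ∀ p, c p < θ 𝒩

/-- The rectangle {0,…,M−1} × {0,…,N'−1}. -/
def Rect (M N' : ℕ) : Set Cell :=
  {p | 0 ≤ p.1 ∧ p.1 < (M : ℤ) ∧ 0 ≤ p.2 ∧ p.2 < (N' : ℤ)}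

/-- The four corners of the rectangle. -/
def Corners (M N' : ℕ) : Set Cell :=
  {(0, 0), ((M : ℤ) - 1, 0), (0, (N' : ℤ) - 1), ((M : ℤ) - 1, (N' : ℤ) - 1)}

/-- The four sides of the rectangle. -/
def side (M N' : ℕ) (i : Fin 4) : Set Cell :=
  if i = 0 then {p | p.1 = 0 ∧ 0 ≤ p.2 ∧ p.2 < (N' : ℤ)}
  else if i = 1 then {p | p.2 = 0 ∧ 0 ≤ p.1 ∧ p.1 < (M : ℤ)}
  else if i = 2 then {p | p.1 = (M : ℤ) - 1 ∧ 0 ≤ p.2 ∧ p.2 < (N' : ℤ)}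
  else {p | p.2 = (N' : ℤ) - 1 ∧ 0 ≤ p.1 ∧ p.1 < (M : ℤ)}

/-- A timed crossover gate of size M × N' and delay T for the sandpile model 𝒩:
a stable configuration `g` supported on the rectangle, together with four
non-corner cells `n`, `e`, `s`, `w` on four pairwise different sides, `n, s`
(resp. `w, e`) on opposite sides, such that adding a grain at `n` (resp. `w`)
makes `s` (resp. `e`) reach the threshold at time exactly `T`, while no cell
on the two other sides reaches the threshold at any time `t ≤ T`. -/
def IsTimedCrossoverGate (𝒩 : Finset Cell) (M N' T : ℕ)
    (g : Config) (n e s w : Cell) : Prop :=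
  Stable 𝒩 g ∧
  (∀ p, p ∉ Rect M N' → g p = 0) ∧
  n ∈ Rect M N' ∧ e ∈ Rect M N' ∧ s ∈ Rect M N' ∧ w ∈ Rect M N' ∧
  n ∉ Corners M N' ∧ e ∉ Corners M N' ∧ s ∉ Corners M N' ∧ w ∉ Corners M N' ∧
  ∃ iN iE iS iW : Fin 4,
    n ∈ side M N' iN ∧ e ∈ side M N' iE ∧ s ∈ side M N' iS ∧ w ∈ side M N' iW ∧
    ((iN : ℤ) - (iS : ℤ)).natAbs = 2 ∧
    ((iW : ℤ) - (iE : ℤ)).natAbs = 2 ∧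
    ({iN, iE, iS, iW} : Finset (Fin 4)) = Finset.univ ∧
    θ 𝒩 ≤ (F 𝒩)^[T] (g + one n) s ∧
    (∀ p ∈ side M N' iW ∪ side M N' iE, ∀ t ≤ T, (F 𝒩)^[t] (g + one n) p < θ 𝒩) ∧
    θ 𝒩 ≤ (F 𝒩)^[T] (g + one w) e ∧
    (∀ p ∈ side M N' iN ∪ side M N' iS, ∀ t ≤ T, (F 𝒩)^[t] (g + one w) p < θ 𝒩)

/-- The configuration at time `t` of an evolution from `c` in which the cell `p` topples exactly
once, at time `τ p`. -/
def firingState (𝒩 : Finset Cell) (c : Config) (τ : Cell → ℕ) (t : ℕ) : Config := fun p =>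
  c p + ∑ d ∈ 𝒩, (if τ (p - d) < t then 1 else 0) - θ 𝒩 * (if τ p < t then 1 else 0)

/-- If, in the evolution prescribed by the firing times `τ`, the cells reaching the threshold at
each time before `T` are exactly those scheduled at that time, then this evolution is the actual
one up to time `T`. -/
theorem iterate_F_eq_firingState {𝒩 : Finset Cell} {c : Config} {τ : Cell → ℕ} {T : ℕ}
    (h : ∀ t < T, ∀ p, θ 𝒩 ≤ firingState 𝒩 c τ t p ↔ τ p = t) :
    ∀ t ≤ T, (F 𝒩)^[t] c = firingState 𝒩 c τ t := by
  intro t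
  induction t with
  | zero => intro _; funext p; simp [firingState]
  | succ t ih =>
    intro ht
    rw [Function.iterate_succ_apply', ih (by omega)]
    funext p
    have hsum : ∑ d ∈ 𝒩, (if τ (p - d) < t + 1 then 1 else 0) =
        ∑ d ∈ 𝒩, (if τ (p - d) < t then 1 else 0) +
          ∑ d ∈ 𝒩, (if τ (p - d) = t then 1 else 0) := by
      rw [← Finset.sum_add_distrib]
      refine Finset.sum_congr rfl fun d _ => ?_
      split_ifs <;> omega
    simp only [F, h t ht]
    unfold firingState
    rw [hsum]
    rcases lt_trichotomy (τ p) t with hlt | heq | hgt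
    · have hθ := (h (τ p) (by omega) p).2 rfl
      have hmono : ∑ d ∈ 𝒩, (if τ (p - d) < τ p then 1 else 0) ≤
          ∑ d ∈ 𝒩, (if τ (p - d) < t then 1 else 0) := by
        refine Finset.sum_le_sum fun d _ => ?_
        split_ifs <;> omega
      simp only [firingState, lt_irrefl, if_false, mul_zero, Nat.sub_zero] at hθ
      simp only [hlt, hlt.ne, Nat.lt_succ_of_lt hlt, if_true, if_false]
      omega
    · have hθ := (h t ht p).2 heq
      simp only [firingState, heq, lt_irrefl, if_false, mul_zero, Nat.sub_zero] at hθ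
      simp only [heq, lt_irrefl, Nat.lt_succ_self, if_true, if_false]
      omega
    · have h1 : ¬ τ p < t := by omega
      have h2 : ¬ τ p < t + 1 := by omega
      simp only [hgt.ne', h1, h2, if_false]
      omega

/-- The function on cells given by a table of values (listed row by row, from the row `y = 0` up)
and equal to `default` outside the table. -/
def tabulate (rows : List (List ℕ)) (default : ℕ) : Cell → ℕ
  | (Int.ofNat x, Int.ofNat y) => (rows.getD y []).getD x default
  | _ => default

theorem tabulate_eq_default {rows : List (List ℕ)} {default M N : ℕ}
    (hN : rows.length ≤ N) (hM : ∀ r ∈ rows, r.length ≤ M) {p : Cell} (hp : p ∉ Rect M N) :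
    tabulate rows default p = default := by
  obtain ⟨x, y⟩ := p
  rcases x with x | x <;> rcases y with y | y <;> try rfl
  have hxy : N ≤ y ∨ M ≤ x := by
    by_contra! hlt
    exact hp ⟨Int.natCast_nonneg x, Int.ofNat_lt.2 hlt.2, Int.natCast_nonneg y,
      Int.ofNat_lt.2 hlt.1⟩
  change (rows.getD y []).getD x default = default
  by_cases hy : y < rows.length
  · have hr := hM _ (List.getElem_mem hy)
    rw [List.getD_eq_getElem _ _ hy]
    exact List.getD_eq_default _ _ (by omega)
  · rw [List.getD_eq_default rows [] (by omega)]
    rfl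

/-- The neighborhood 211. -/
abbrev nbhd211 : Finset Cell := {(0,1),(1,0),(-1,0),(1,-1),(-1,-1)}

/-- The crossover gate configuration. -/
def gate : Config := tabulate
  [
   [0, 0, 3, 3, 2, 0, 0, 0, 0, 4, 0, 0],
   [0, 4, 3, 3, 4, 4, 0, 0, 0, 0, 4, 0],
   [0, 4, 3, 0, 4, 0, 4, 1, 3, 3, 0, 0],
   [0, 1, 4, 1, 2, 4, 0, 4, 3, 3, 4, 0],
   [2, 4, 4, 4, 0, 4, 2, 2, 4, 3, 3, 4],
   [4, 0, 3, 3, 4, 4, 1, 4, 0, 4, 3, 3],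
   [4, 4, 0, 3, 4, 4, 3, 4, 2, 2, 4, 0],
   [3, 3, 2, 4, 3, 4, 3, 1, 3, 4, 2, 3],
   [0, 2, 4, 3, 2, 3, 4, 3, 3, 2, 4, 2],
   [0, 3, 4, 1, 3, 3, 4, 1, 1, 4, 2, 0],
   [0, 3, 3, 4, 1, 2, 2, 2, 4, 2, 3, 3],
   [0, 4, 4, 4, 4, 4, 4, 4, 0, 0, 0, 0]] 0

/-- The firing times before time 17 of the evolution from the gate with a grain added on the top
side; the other cells are assigned the value 17. -/
def northTime : Cell → ℕ := tabulate
  [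
   [17, 17, 17, 16, 17, 17, 17, 17, 17, 17, 17, 17],
   [17, 16, 15, 14, 12, 11, 17, 17, 17, 17, 17, 17],
   [17, 13, 16, 17, 13, 15, 10, 17, 16, 17, 17, 17],
   [17, 17, 12, 16, 14, 13, 14, 9, 14, 15, 16, 17],
   [17, 13, 12, 11, 15, 11, 12, 13, 8, 16, 17, 17],
   [17, 17, 12, 11, 10, 9, 12, 11, 17, 7, 17, 17],
   [17, 17, 17, 9, 8, 9, 10, 11, 17, 16, 6, 17],
   [17, 17, 17, 7, 8, 9, 11, 16, 15, 5, 17, 17],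
   [17, 17, 6, 7, 14, 13, 12, 14, 15, 16, 4, 17],
   [17, 5, 4, 16, 15, 14, 13, 15, 16, 3, 17, 17],
   [17, 5, 4, 3, 16, 15, 14, 15, 2, 17, 17, 17],
   [17, 5, 4, 3, 2, 1, 0, 1, 17, 17, 17, 17]] 17

/-- The firing times before time 17 of the evolution from the gate with a grain added on the left
side; the other cells are assigned the value 17. -/
def westTime : Cell → ℕ := tabulate
  [
   [17, 17, 17, 17, 17, 17, 17, 17, 17, 17, 17, 17],
   [17, 17, 17, 16, 15, 14, 17, 17, 17, 17, 17, 17],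
   [17, 3, 16, 17, 13, 15, 13, 16, 15, 16, 17, 17],
   [17, 17, 2, 15, 13, 12, 14, 12, 13, 14, 15, 17],
   [17, 1, 2, 3, 14, 6, 11, 12, 11, 15, 16, 17],
   [0, 17, 3, 4, 5, 6, 11, 10, 17, 16, 17, 17],
   [1, 2, 17, 7, 6, 7, 9, 10, 17, 17, 17, 17],
   [17, 17, 17, 8, 9, 8, 10, 17, 17, 17, 17, 17],
   [17, 17, 16, 15, 14, 12, 11, 13, 17, 17, 17, 17],
   [17, 17, 17, 17, 15, 13, 12, 17, 17, 17, 17, 17],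
   [17, 17, 17, 17, 17, 17, 17, 17, 17, 17, 17, 17],
   [17, 17, 17, 17, 17, 17, 17, 17, 17, 17, 17, 17]] 17

theorem gate_eq_zero {p : Cell} (hp : p ∉ Rect 12 12) : gate p = 0 :=
  tabulate_eq_default (by decide) (by decide) hp

theorem northTime_eq {p : Cell} (hp : p ∉ Rect 12 12) : northTime p = 17 :=
  tabulate_eq_default (by decide) (by decide) hp

theorem westTime_eq {p : Cell} (hp : p ∉ Rect 12 12) : westTime p = 17 :=
  tabulate_eq_default (by decide) (by decide) hp

theorem theta_nbhd211 : θ nbhd211 = 5 := by decide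

theorem firingState_nbhd211 (c : Config) (τ : Cell → ℕ) (t : ℕ) (x y : ℤ) :
    firingState nbhd211 c τ t (x, y) =
      c (x, y) + ((if τ (x, y - 1) < t then 1 else 0) + ((if τ (x - 1, y) < t then 1 else 0) +
        ((if τ (x + 1, y) < t then 1 else 0) + ((if τ (x - 1, y + 1) < t then 1 else 0) +
          (if τ (x + 1, y + 1) < t then 1 else 0))))) - 5 * (if τ (x, y) < t then 1 else 0) := by
  rw [firingState, theta_nbhd211]
  repeat rw [Finset.sum_insert (by decide)]
  rw [Finset.sum_singleton]
  simp

/-- For configurations supported on the square of side 12, a firing schedule for the neighborhood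
211 need only be verified on the square enlarged by one cell in each direction. -/
theorem iterate_F_nbhd211 {c : Config} {τ : Cell → ℕ}
    (hc : ∀ p, p ∉ Rect 12 12 → c p = 0) (hτ : ∀ p, p ∉ Rect 12 12 → τ p = 17)
    (h : ∀ x < 14, ∀ y < 14, ∀ t < 17,
      5 ≤ firingState nbhd211 c τ t ((x : ℕ) - 1, (y : ℕ) - 1) ↔ τ ((x : ℕ) - 1, (y : ℕ) - 1) = t) :
    ∀ t ≤ 17, (F nbhd211)^[t] c = firingState nbhd211 c τ t := by
  refine iterate_F_eq_firingState fun t ht p => ?_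
  obtain ⟨x, y⟩ := p
  rw [theta_nbhd211]
  by_cases hxy : -1 ≤ x ∧ x < 13 ∧ -1 ≤ y ∧ y < 13
  · have := h (x + 1).toNat (by omega) (y + 1).toNat (by omega) t ht
    rwa [Int.toNat_of_nonneg (by omega), Int.toNat_of_nonneg (by omega), add_sub_cancel_right,
      add_sub_cancel_right] at this
  · rw [firingState_nbhd211, hc, hτ (x, y), hτ (x, y - 1), hτ (x - 1, y), hτ (x + 1, y),
      hτ (x - 1, y + 1), hτ (x + 1, y + 1)]
    · split_ifs <;> omega
    all_goals
      simp only [Rect, Set.mem_ofPred_eq]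
      omega

theorem iterate_F_gate_north : ∀ t ≤ 17,
    (F nbhd211)^[t] (gate + one (6, 11)) = firingState nbhd211 (gate + one (6, 11)) northTime t := by
  refine iterate_F_nbhd211 (fun p hp => ?_) (fun p => northTime_eq) ?_
  · have hne : p ≠ (6, 11) := by rintro rfl; exact hp (by simp [Rect])
    simp [gate_eq_zero hp, one, hne]
  · simp only [firingState_nbhd211]
    decide +kernel

theorem iterate_F_gate_west : ∀ t ≤ 17,
    (F nbhd211)^[t] (gate + one (0, 5)) = firingState nbhd211 (gate + one (0, 5)) westTime t := by
  refine iterate_F_nbhd211 (fun p hp => ?_) (fun p => westTime_eq) ?_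
  · have hne : p ≠ (0, 5) := by rintro rfl; exact hp (by simp [Rect])
    simp [gate_eq_zero hp, one, hne]
  · simp only [firingState_nbhd211]
    decide +kernel

theorem gate_stable : Stable nbhd211 gate := by
  intro p
  rw [theta_nbhd211]
  by_cases hp : p ∈ Rect 12 12
  · obtain ⟨x, y⟩ := p
    obtain ⟨hx, hx', hy, hy'⟩ := hp
    dsimp only at hx hx' hy hy'
    lift x to ℕ using hx
    lift y to ℕ using hy
    have key : ∀ x < 12, ∀ y < 12, gate ((x : ℕ), (y : ℕ)) < 5 := by decide +kernel
    exact key x (by omega) y (by omega)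
  · rw [gate_eq_zero hp]
    norm_num

theorem gate_north_lt : ∀ p ∈ side 12 12 0 ∪ side 12 12 2, ∀ t ≤ 17,
    (F nbhd211)^[t] (gate + one (6, 11)) p < θ nbhd211 := by
  rintro ⟨x, y⟩ hp t ht
  rw [iterate_F_gate_north t ht, theta_nbhd211, firingState_nbhd211]
  simp only [side, Set.mem_union, Fin.isValue, Fin.reduceEq, if_true, if_false,
    Set.mem_ofPred_eq] at hp
  have key : ∀ y < 12, ∀ t < 18, ∀ x ∈ [(0 : ℤ), 11],
      firingState nbhd211 (gate + one (6, 11)) northTime t (x, (y : ℕ)) < 5 := by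
    simp only [firingState_nbhd211]
    decide +kernel
  simp only [firingState_nbhd211] at key
  lift y to ℕ using by omega
  exact key y (by omega) t (by omega) x (by simp; omega)

theorem gate_west_lt : ∀ p ∈ side 12 12 3 ∪ side 12 12 1, ∀ t ≤ 17,
    (F nbhd211)^[t] (gate + one (0, 5)) p < θ nbhd211 := by
  rintro ⟨x, y⟩ hp t ht
  rw [iterate_F_gate_west t ht, theta_nbhd211, firingState_nbhd211]
  simp only [side, Set.mem_union, Fin.isValue, Fin.reduceEq, if_true, if_false,
    Set.mem_ofPred_eq] at hp
  have key : ∀ x < 12, ∀ t < 18, ∀ y ∈ [(0 : ℤ), 11],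
      firingState nbhd211 (gate + one (0, 5)) westTime t ((x : ℕ), y) < 5 := by
    simp only [firingState_nbhd211]
    decide +kernel
  simp only [firingState_nbhd211] at key
  lift x to ℕ using by omega
  exact key x (by omega) t (by omega) y (by simp; omega)

theorem nbhd211_timed_crossover :
    ∃ g n e s w, IsTimedCrossoverGate
      ({(0,1),(1,0),(-1,0),(1,-1),(-1,-1)} : Finset Cell) 12 12 17 g n e s w := by
  refine ⟨gate, (6, 11), (11, 4), (4, 0), (0, 5), gate_stable, fun p => gate_eq_zero,
    by simp [Rect], by simp [Rect], by simp [Rect], by simp [Rect],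
    by simp [Corners], by simp [Corners], by simp [Corners], by simp [Corners],
    3, 2, 1, 0, by simp [side], by simp [side], by simp [side], by simp [side],
    by decide, by decide, by decide, ?_, gate_north_lt, ?_, gate_west_lt⟩
  · rw [iterate_F_gate_north 17 le_rfl, theta_nbhd211, firingState_nbhd211]
    decide +kernel
  · rw [iterate_F_gate_west 17 le_rfl, theta_nbhd211, firingState_nbhd211]
    decide +kernel

end Sandpile
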